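/- Let n ≥ 2 and let W_1 ≤ W_2 ≤ ⋯ ≤ W_n be positive reals. Let k ∈ [n] be the largest good index (it exists since k = 1 is always good), set D' = Σ_{i=1}^k W_i and C' = Σ_{i=1}^k 1/W_i, and define q_i = (D'/W_i − (k−2))/(D'C' − k(k−2)) for i ≤ k and q_i = 0 for i > k. Then all q_i ≥ 0, Σ_{i=1}^n q_i = 1, and for every i* ∈ [n], 1 + Σ_{i≠i*} q_i·(1 + W_i/W_{i*}) ≤ 3 − 2/n. (Lemma 3.3 / Step 2, the rounding procedure preserves the 3 − 2/n approximation.) -/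

import Mathlib

/-- An index `k` (number of hypotheses considered, indices `0, …, k−1`) is *good*
for the weights `W` if `(k−3)·W j ≤ Σ_{i < k, i ≠ j} W i` for every `j < k`. -/
def IsGoodIndex (W : ℕ → ℝ) (k : ℕ) : Prop :=
  ∀ j ∈ Finset.range k, ((k : ℝ) - 3) * W j ≤ ∑ i ∈ (Finset.range k).erase j, W i

theorem isGoodIndex_iff (W : ℕ → ℝ) (k : ℕ) :
    IsGoodIndex W k ↔ ∀ j < k, ((k : ℝ) - 2) * W j ≤ ∑ i ∈ Finset.range k, W i := by
  unfold IsGoodIndex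
  simp only [Finset.mem_range]
  refine forall₂_congr fun j hj => ?_
  rw [← Finset.add_sum_erase _ W (Finset.mem_range.2 hj)]
  constructor <;> intro h <;> linarith

theorem card_sq_le_sum_mul_sum_inv {ι : Type*} (s : Finset ι) (W : ι → ℝ)
    (hpos : ∀ i ∈ s, 0 < W i) :
    (s.card : ℝ) ^ 2 ≤ (∑ i ∈ s, W i) * ∑ i ∈ s, (W i)⁻¹ := by
  have h := Finset.sum_sq_le_sum_mul_sum_of_sq_le_mul s (r := fun _ => (1 : ℝ))
    (f := W) (g := fun i => (W i)⁻¹) (fun i hi => (hpos i hi).le)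
    (fun i hi => (inv_pos.2 (hpos i hi)).le)
    (fun i hi => by simp [mul_inv_cancel₀ (hpos i hi).ne'])
  simpa using h

/-- **Lemma 3.3 / Step 2** (the rounding procedure preserves the `3 − 2/n` factor).
For sorted positive weights `W 0 ≤ ⋯ ≤ W (n−1)` with `n ≥ 2`, let `k` be the largest
good index, `D' = Σ_{i<k} W i`, `C' = Σ_{i<k} 1/W i`, and
`q i = (D'/W i − (k−2))/(D'C' − k(k−2))` for `i < k`, `q i = 0` otherwise. Then all
`q i ≥ 0`, they sum to `1`, and for every `i*`,
`1 + Σ_{i≠i*} q i·(1 + W i / W i*) ≤ 3 − 2/n`. -/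
theorem rounding_preserves_factor (n : ℕ) (hn : 2 ≤ n) (W : ℕ → ℝ)
    (hpos : ∀ i, i < n → 0 < W i)
    (hmono : ∀ i j, i ≤ j → j < n → W i ≤ W j)
    (k : ℕ) (hk1 : 1 ≤ k) (hkn : k ≤ n)
    (hgood : IsGoodIndex W k)
    (hmax : ∀ k', k' ≤ n → IsGoodIndex W k' → k' ≤ k)
    (D' C' : ℝ)
    (hD' : D' = ∑ i ∈ Finset.range k, W i)
    (hC' : C' = ∑ i ∈ Finset.range k, (W i)⁻¹)
    (q : ℕ → ℝ)
    (hq : ∀ i, q i = if i < k then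
        (D' / W i - ((k : ℝ) - 2)) / (D' * C' - (k : ℝ) * ((k : ℝ) - 2)) else 0) :
    (∀ i, 0 ≤ q i) ∧
    (∑ i ∈ Finset.range n, q i = 1) ∧
    ∀ istar ∈ Finset.range n,
      1 + ∑ i ∈ (Finset.range n).erase istar, q i * (1 + W i / W istar)
        ≤ 3 - 2 / (n : ℝ) := by
  have hposk : ∀ i ∈ Finset.range k, 0 < W i := fun i hi =>
    hpos i ((Finset.mem_range.1 hi).trans_le hkn)
  have hk2 : 2 ≤ k := by
    refine hmax 2 hn ((isGoodIndex_iff W 2).2 fun j _ => ?_)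
    have h0 : 0 ≤ ∑ i ∈ Finset.range 2, W i := Finset.sum_nonneg fun i hi =>
      (hpos i ((Finset.mem_range.1 hi).trans_le hn)).le
    simpa using h0
  have hk2' : (2 : ℝ) ≤ k := by exact_mod_cast hk2
  have hkn' : (k : ℝ) ≤ n := by exact_mod_cast hkn
  have hD'C' : (k : ℝ) ^ 2 ≤ D' * C' := by
    simpa [hD', hC'] using card_sq_le_sum_mul_sum_inv (Finset.range k) W hposk
  set den : ℝ := D' * C' - (k : ℝ) * ((k : ℝ) - 2) with hden
  have hden_ge : 2 * (k : ℝ) ≤ den := by rw [hden]; nlinarith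
  have hden_pos : 0 < den := by linarith
  have hqk : ∀ i ∈ Finset.range k, q i = (D' / W i - ((k : ℝ) - 2)) / den := fun i hi => by
    rw [hq, if_pos (Finset.mem_range.1 hi)]
  have hq0 : ∀ i, k ≤ i → q i = 0 := fun i hi => by rw [hq, if_neg hi.not_gt]
  have hrange : ∀ f : ℕ → ℝ,
      ∑ i ∈ Finset.range n, q i * f i = ∑ i ∈ Finset.range k, q i * f i := fun f => by
    refine (Finset.sum_subset (Finset.range_mono hkn) fun i _ hi => ?_).symm
    rw [hq0 i (by simpa using hi), zero_mul]
  have hsum : ∑ i ∈ Finset.range n, q i = 1 := by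
    have h1 : ∑ i ∈ Finset.range k, q i = den / den := by
      rw [Finset.sum_congr rfl hqk, ← Finset.sum_div]
      simp only [div_eq_mul_inv D', Finset.sum_sub_distrib, ← Finset.mul_sum, ← hC',
        Finset.sum_const, Finset.card_range, nsmul_eq_mul, hden]
      ring
    simpa [h1, hden_pos.ne'] using hrange fun _ => 1
  have hsumW : ∑ i ∈ Finset.range n, q i * W i = 2 * D' / den := by
    rw [hrange]
    have h1 : ∀ i ∈ Finset.range k, q i * W i = (D' - ((k : ℝ) - 2) * W i) / den := by
      intro i hi
      have := (hposk i hi).ne'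
      rw [hqk i hi]
      field_simp
    rw [Finset.sum_congr rfl h1, ← Finset.sum_div, Finset.sum_sub_distrib, ← Finset.mul_sum,
      ← hD', Finset.sum_const, Finset.card_range, nsmul_eq_mul]
    ring
  have hbound : 2 + 2 * ((k : ℝ) - 2) / den ≤ 3 - 2 / n := by
    have h1 : 2 * ((k : ℝ) - 2) / den ≤ 2 * ((k : ℝ) - 2) / (2 * k) := by gcongr
    have h2 : 2 * ((k : ℝ) - 2) / (2 * k) = 1 - 2 / k := by field_simp
    have h3 : 2 / (n : ℝ) ≤ 2 / k := by gcongr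
    linarith
  refine ⟨fun i => ?_, hsum, fun m hm => ?_⟩
  · rcases lt_or_ge i k with hi | hi
    · rw [hqk i (Finset.mem_range.2 hi)]
      have h := (isGoodIndex_iff W k).1 hgood i hi
      rw [← hD', ← le_div_iff₀ (hposk i (Finset.mem_range.2 hi))] at h
      exact div_nonneg (sub_nonneg.2 h) hden_pos.le
    · exact (hq0 i hi).ge
  · have hm' := Finset.mem_range.1 hm
    have hWm := hpos m hm'
    have hval : 1 + ∑ i ∈ (Finset.range n).erase m, q i * (1 + W i / W m)
        = 2 - 2 * q m + 2 * D' / den / W m := by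
      have h1 := Finset.add_sum_erase (Finset.range n) (fun i => q i * (1 + W i / W m)) hm
      have h2 : ∑ i ∈ Finset.range n, q i * (1 + W i / W m) = 1 + 2 * D' / den / W m := by
        simp only [mul_add, mul_one, ← mul_div_assoc, Finset.sum_add_distrib,
          ← Finset.sum_div, hsum, hsumW]
      simp only [h2, div_self hWm.ne'] at h1
      linarith
    rw [hval]
    refine le_trans ?_ hbound
    rcases lt_or_ge m k with hmk | hmk
    · rw [hqk m (Finset.mem_range.2 hmk)]
      apply le_of_eq
      field_simp
      ring
    · have hD'le : D' ≤ ((k : ℝ) - 2) * W m := by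
        by_contra! hlt
        have := hmax (k + 1) (by omega) ((isGoodIndex_iff W (k + 1)).2 fun j hj => ?_)
        · omega
        · have hjk : W j ≤ W k := hmono j k (by omega) (by omega)
          have hkm : W k ≤ W m := hmono k m hmk hm'
          rw [Finset.sum_range_succ, ← hD']
          push_cast
          nlinarith
      rw [hq0 m hmk, div_right_comm]
      have h1 : 2 * D' / W m ≤ 2 * ((k : ℝ) - 2) := by
        rw [div_le_iff₀ hWm]
        linarith
      have h2 : 2 * D' / W m / den ≤ 2 * ((k : ℝ) - 2) / den := by gcongr
      linarith
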